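/- arXiv:math/0608212 — 2 statements merged into one kernel-verified Lean document; each statement's English description precedes it below -/
import Mathlib

section
/- Let G be a non-elementary hyperbolic group and let g ∈ G be an element whose conjugacy class is finite. Then g has finite order. -/
section Preamble

variable {G : Type*} [Group G]

/-- The word length of `g : G` with respect to the generating set `S`. -/
noncomputable def wordLength (S : Set G) (g : G) : ℕ :=
  sInf {n | ∃ w : List G, (∀ x ∈ w, x ∈ S) ∧ w.length = n ∧ w.prod = g}

/-- The word metric `d(x, y) = |x⁻¹ y|` on the Cayley graph of `G`. -/
noncomputable def wordDist (S : Set G) (x y : G) : ℕ := wordLength S (x⁻¹ * y)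

/-- `S` is a finite generating set of `G` closed under inversion. -/
def IsGenSet (S : Set G) : Prop :=
  S.Finite ∧ (∀ x ∈ S, x⁻¹ ∈ S) ∧ Subgroup.closure S = ⊤

/-- `γ`, restricted to `{0, …, n}`, is a geodesic segment in the Cayley graph. -/
def IsGeodesicSegment (S : Set G) (γ : ℕ → G) (n : ℕ) : Prop :=
  ∀ i j, i ≤ n → j ≤ n → wordDist S (γ i) (γ j) = Nat.dist i j

/-- `r : ℕ → G` is a geodesic ray in the Cayley graph. -/
def IsGeodesicRay (S : Set G) (r : ℕ → G) : Prop :=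
  ∀ i j, wordDist S (r i) (r j) = Nat.dist i j

/-- Every geodesic triangle in the Cayley graph of `G` is `δ`-thin: each side lies in
the `δ`-neighborhood of the union of the other two sides. -/
def IsDeltaHyperbolic (S : Set G) (δ : ℕ) : Prop :=
  ∀ (γ₁ γ₂ γ₃ : ℕ → G) (n₁ n₂ n₃ : ℕ),
    IsGeodesicSegment S γ₁ n₁ → IsGeodesicSegment S γ₂ n₂ → IsGeodesicSegment S γ₃ n₃ →
    γ₁ 0 = γ₃ 0 → γ₁ n₁ = γ₂ 0 → γ₂ n₂ = γ₃ n₃ →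
    ∀ k ≤ n₃, ∃ i, (i ≤ n₁ ∧ wordDist S (γ₃ k) (γ₁ i) ≤ δ) ∨
      (i ≤ n₂ ∧ wordDist S (γ₃ k) (γ₂ i) ≤ δ)

/-- `G` is hyperbolic with respect to `S`: some `δ` makes all triangles `δ`-thin. -/
def IsHyperbolic (S : Set G) : Prop := ∃ δ : ℕ, IsDeltaHyperbolic S δ

/-- `H` is a `K`-quasiconvex subgroup: every geodesic between points of `H`
lies in the `K`-neighborhood of `H`. -/
def IsQuasiconvex (S : Set G) (H : Subgroup G) (K : ℕ) : Prop :=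
  ∀ (γ : ℕ → G) (n : ℕ), IsGeodesicSegment S γ n → γ 0 ∈ H → γ n ∈ H →
    ∀ i ≤ n, ∃ h ∈ H, wordDist S (γ i) h ≤ K

/-- Property (*): there is a set-theoretic section `s : G/H → G` of the coset
projection whose image is a net in `G` for the word metric of `S`. -/
def SatisfiesStar (S : Set G) (H : Subgroup G) : Prop :=
  ∃ s : G ⧸ H → G, (∀ q : G ⧸ H, (QuotientGroup.mk (s q) : G ⧸ H) = q) ∧
    ∃ C : ℕ, ∀ g : G, ∃ q : G ⧸ H, wordDist S g (s q) ≤ C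

/-- A hyperbolic group is elementary if it is finite or has an infinite cyclic
subgroup of finite index. -/
def IsElementary (G : Type*) [Group G] : Prop :=
  Finite G ∨ ∃ H : Subgroup G, IsCyclic H ∧ Infinite H ∧ H.index ≠ 0

end Preamble

section Helpers

variable {G : Type*} [Group G] {S : Set G}

lemma wl_exists (hS : IsGenSet S) (g : G) :
    ∃ w : List G, (∀ x ∈ w, x ∈ S) ∧ w.length = wordLength S g ∧ w.prod = g := by
  have hne : {n | ∃ w : List G, (∀ x ∈ w, x ∈ S) ∧ w.length = n ∧ w.prod = g}.Nonempty := by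
    have hg : g ∈ Subgroup.closure S := by rw [hS.2.2]; trivial
    rw [← Subgroup.mem_toSubmonoid, Subgroup.closure_toSubmonoid] at hg
    obtain ⟨l, hl, hp⟩ := Submonoid.exists_list_of_mem_closure hg
    refine ⟨l.length, l, fun x hx => ?_, rfl, hp⟩
    rcases hl x hx with h | h
    · exact h
    · simpa using hS.2.1 _ h
  exact Nat.sInf_mem hne

lemma wl_le {w : List G} (hw : ∀ x ∈ w, x ∈ S) : wordLength S w.prod ≤ w.length :=
  Nat.sInf_le ⟨w, hw, rfl, rfl⟩

lemma wl_mul (hS : IsGenSet S) (a b : G) :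
    wordLength S (a * b) ≤ wordLength S a + wordLength S b := by
  obtain ⟨u, hu, hul, hup⟩ := wl_exists hS a
  obtain ⟨v, hv, hvl, hvp⟩ := wl_exists hS b
  have := wl_le (S := S) (w := u ++ v) (by
    intro x hx
    rcases List.mem_append.1 hx with h | h
    · exact hu x h
    · exact hv x h)
  rw [List.prod_append, hup, hvp, List.length_append] at this
  omega

lemma wl_inv_le (hS : IsGenSet S) (a : G) : wordLength S a⁻¹ ≤ wordLength S a := by
  obtain ⟨u, hu, hul, hup⟩ := wl_exists hS a
  have := wl_le (S := S) (w := (u.map (·⁻¹)).reverse) (by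
    intro x hx
    simp only [List.mem_reverse, List.mem_map] at hx
    obtain ⟨y, hy, rfl⟩ := hx
    exact hS.2.1 _ (hu y hy))
  rw [← List.prod_inv_reverse, hup, List.length_reverse, List.length_map] at this
  omega

lemma wl_inv (hS : IsGenSet S) (a : G) : wordLength S a⁻¹ = wordLength S a := by
  apply le_antisymm (wl_inv_le hS a)
  simpa using wl_inv_le hS a⁻¹

lemma wd_comm (hS : IsGenSet S) (x y : G) : wordDist S x y = wordDist S y x := by
  unfold wordDist
  rw [← wl_inv hS]
  simp

lemma wd_tri (hS : IsGenSet S) (x y z : G) :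
    wordDist S x z ≤ wordDist S x y + wordDist S y z := by
  unfold wordDist
  have := wl_mul hS (x⁻¹ * y) (y⁻¹ * z)
  simpa [mul_assoc] using this

lemma wd_left (a x y : G) : wordDist S (a * x) (a * y) = wordDist S x y := by
  unfold wordDist
  simp [mul_assoc]

lemma geo_left {γ : ℕ → G} {n : ℕ} (a : G) (h : IsGeodesicSegment S γ n) :
    IsGeodesicSegment S (fun i => a * γ i) n := by
  intro i j hi hj
  simpa only [wd_left] using h i j hi hj

lemma geo_one (hS : IsGenSet S) (g : G) :
    ∃ γ : ℕ → G, IsGeodesicSegment S γ (wordLength S g) ∧ γ 0 = 1 ∧ γ (wordLength S g) = g := by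
  obtain ⟨w, hw, hwl, hwp⟩ := wl_exists hS g
  refine ⟨fun i => (w.take i).prod, ?_, by simp, by simp [← hwl, hwp]⟩
  have key : ∀ i j, i ≤ j → j ≤ wordLength S g →
      wordDist S (w.take i).prod (w.take j).prod = j - i := by
    intro i j hij hj
    have h1 : (w.take i).prod * ((w.take j).drop i).prod = (w.take j).prod := by
      rw [← List.prod_append]
      congr 1
      have := List.take_append_drop i (w.take j)
      rwa [List.take_take, min_eq_left hij] at this
    have e1 : (w.take i).prod⁻¹ * (w.take j).prod = ((w.take j).drop i).prod := by
      rw [← h1]; simp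
    have h2 : (w.take j).prod * (w.drop j).prod = g := by
      rw [← List.prod_append, List.take_append_drop, hwp]
    have l1 := wl_le (S := S) (w := w.take i) (fun x hx => hw x (List.mem_of_mem_take hx))
    have l2 := wl_le (S := S) (w := (w.take j).drop i)
      (fun x hx => hw x (List.mem_of_mem_take (List.mem_of_mem_drop hx)))
    have l3 := wl_le (S := S) (w := w.drop j) (fun x hx => hw x (List.mem_of_mem_drop hx))
    have t1 := wl_mul hS (w.take j).prod (w.drop j).prod
    have t2 := wl_mul hS (w.take i).prod ((w.take j).drop i).prod
    rw [h2] at t1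
    rw [h1] at t2
    simp only [List.length_take, List.length_drop] at l1 l2 l3
    unfold wordDist
    rw [e1]
    omega
  intro i j hi hj
  rcases le_total i j with h | h
  · rw [key i j h hj, Nat.dist_eq_sub_of_le h]
  · rw [wd_comm hS, key j i h hi, Nat.dist_comm, Nat.dist_eq_sub_of_le h]

lemma geo_exists (hS : IsGenSet S) (a b : G) :
    ∃ γ : ℕ → G, IsGeodesicSegment S γ (wordDist S a b) ∧ γ 0 = a ∧ γ (wordDist S a b) = b := by
  obtain ⟨γ, h, h0, h1⟩ := geo_one hS (a⁻¹ * b)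
  refine ⟨fun i => a * γ i, geo_left a h, by simp [h0], ?_⟩
  change a * γ (wordLength S (a⁻¹ * b)) = b
  rw [h1]; simp

lemma ball_finite (hS : IsGenSet S) (k : ℕ) : {h : G | wordLength S h ≤ k}.Finite := by
  haveI : Finite S := hS.1
  refine ((List.finite_length_le S k).image (fun l => (l.map Subtype.val).prod)).subset ?_
  intro h hh
  obtain ⟨w, hw, hwl, hwp⟩ := wl_exists hS h
  refine ⟨w.attach.map (fun x => ⟨x.1, hw x.1 x.2⟩), ?_, ?_⟩
  · simp only [Set.mem_setOf_eq, List.length_map, List.length_attach]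
    exact hwl.trans_le hh
  · simp [List.map_map, Function.comp_def, hwp]

/-- The main shortening lemma. -/
lemma shorten (hS : IsGenSet S) {δ R : ℕ} (hδ : IsDeltaHyperbolic S δ) (a : G)
    (hR : ∀ x, wordDist S x (a * x) ≤ R) (hL : ∀ x, 4 * δ < wordDist S x (a * x))
    (x : G) (hx : 2 * (2 * δ + R) + 4 ≤ wordLength S x) :
    wordLength S (a * x) < wordLength S x ∨ wordLength S (a⁻¹ * x) < wordLength S x := by
  obtain ⟨γ, hγ, h0, h1⟩ := geo_one hS x
  set N := wordLength S x with hN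
  obtain ⟨η, hη, η0, η1⟩ := geo_exists hS (a * 1) x
  obtain ⟨σ, hσ, σ0, σ1⟩ := geo_exists hS x (a * x)
  obtain ⟨τ, hτ, τ0, τ1⟩ := geo_exists hS (a * 1) 1
  have hRx := hR x
  have hR1 := hR 1
  rw [wd_comm hS] at hR1
  set t := N / 2 with ht
  have htN : t ≤ N := by omega
  have dend : wordDist S (a * γ t) (a * x) = N - t := by
    rw [wd_left, ← h1, hγ t N htN le_rfl, Nat.dist_eq_sub_of_le htN]
  have dstart : wordDist S (a * γ t) (a * 1) = t := by
    rw [wd_left, ← h0, hγ t 0 htN (by omega), Nat.dist_comm, Nat.dist_eq_sub_of_le (by omega)]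
    omega
  have main : ∃ s, s ≤ N ∧ wordDist S (a * γ t) (γ s) ≤ 2 * δ := by
    obtain ⟨i, hi | hi⟩ := hδ η σ (fun i => a * γ i) _ _ N hη hσ (geo_left a hγ)
      (by simp [η0, h0]) (by rw [η1, σ0]) (by rw [σ1, h1]) t htN
    · obtain ⟨hi, hd⟩ := hi
      obtain ⟨s, hs | hs⟩ := hδ τ γ η _ _ _ hτ hγ hη (by rw [τ0, η0]) (by rw [τ1, h0])
        (by rw [h1, η1]) i hi
      · obtain ⟨hs, hd'⟩ := hs
        exfalso
        have e : wordDist S (τ s) (a * 1) = s := by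
          rw [← τ0, hτ s 0 hs (by omega), Nat.dist_comm, Nat.dist_eq_sub_of_le (by omega)]
          omega
        have t1 := wd_tri hS (a * γ t) (η i) (a * 1)
        have t2 := wd_tri hS (η i) (τ s) (a * 1)
        omega
      · obtain ⟨hs, hd'⟩ := hs
        refine ⟨s, hs, ?_⟩
        have t1 := wd_tri hS (a * γ t) (η i) (γ s)
        omega
    · obtain ⟨hi, hd⟩ := hi
      exfalso
      have e : wordDist S (σ i) (a * x) = wordDist S x (a * x) - i := by
        conv_lhs => rw [← σ1]
        rw [hσ i _ hi le_rfl, Nat.dist_eq_sub_of_le hi]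
      have t1 := wd_tri hS (a * γ t) (σ i) (a * x)
      omega
  obtain ⟨s, hs, hd⟩ := main
  have wl1 : ∀ y, wordLength S y = wordDist S 1 y := by intro y; simp [wordDist]
  have pos : ∀ i, i ≤ N → wordDist S 1 (γ i) = i := by
    intro i hi
    rw [← h0, hγ 0 i (by omega) hi, Nat.dist_eq_sub_of_le (by omega)]
    omega
  have pos' : ∀ i, i ≤ N → wordDist S (γ i) x = N - i := by
    intro i hi
    conv_lhs => rw [← h1]
    rw [hγ i N hi le_rfl, Nat.dist_eq_sub_of_le hi]
  have hL' := hL (γ t)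
  rw [wd_comm hS] at hL'
  have t1 := wd_tri hS (a * γ t) (γ s) (γ t)
  have ps := pos s hs
  have pt := pos t htN
  have ps' := pos' s hs
  rcases le_total s t with h | h
  · left
    rw [hγ s t hs htN, Nat.dist_eq_sub_of_le h] at t1
    rw [wl1]
    have u1 := wd_tri hS 1 (γ s) (a * x)
    have u2 := wd_tri hS (γ s) (a * γ t) (a * x)
    rw [wd_comm hS (γ s) (a * γ t)] at u2
    omega
  · right
    rw [hγ s t hs htN, Nat.dist_comm, Nat.dist_eq_sub_of_le h] at t1
    rw [wl1]
    have u1 := wd_tri hS 1 (γ t) (a⁻¹ * x)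
    have u2 := wd_tri hS (γ t) (a⁻¹ * γ s) (a⁻¹ * x)
    rw [wd_left] at u2
    have u3 : wordDist S (γ t) (a⁻¹ * γ s) = wordDist S (a * γ t) (γ s) := by
      rw [← wd_left a]; simp
    omega

end Helpers

/-- In a non-elementary hyperbolic group, any element with finite
conjugacy class has finite order. -/
theorem statement_5 {G : Type*} [Group G] (S : Set G) (hGen : IsGenSet S)
    (hHyp : IsHyperbolic S) (hNE : ¬ IsElementary G) (g : G)
    (hg : {h : G | ∃ x : G, h = x⁻¹ * g * x}.Finite) :
    IsOfFinOrder g := by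
  by_contra hinf
  apply hNE
  right
  obtain ⟨δ, hδ⟩ := hHyp
  have hpow : ∀ (n : ℕ) (x : G), x⁻¹ * g ^ n * x = (x⁻¹ * g * x) ^ n := by
    intro n x
    have := conj_pow (i := n) (a := x⁻¹) (b := g)
    simpa using this.symm
  have hinj : Function.Injective (fun n : ℕ => g ^ n) :=
    injective_pow_iff_not_isOfFinOrder.2 hinf
  -- the exponents that are too small somewhere
  have hbad : (⋃ h ∈ {h : G | ∃ x : G, h = x⁻¹ * g * x},
      {n : ℕ | wordLength S (h ^ n) ≤ 4 * δ}).Finite := by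
    refine hg.biUnion ?_
    rintro h ⟨x, rfl⟩
    refine (ball_finite hGen (4 * δ)).preimage (f := fun n : ℕ => (x⁻¹ * g * x) ^ n) ?_
    intro m _ n _ hmn
    apply hinj
    simp only [← hpow] at hmn
    simpa using hmn
  obtain ⟨n, hn⟩ := hbad.exists_notMem
  have hn' : ∀ x : G, 4 * δ < wordLength S ((x⁻¹ * g * x) ^ n) := by
    intro x
    by_contra hc
    exact hn (Set.mem_biUnion (x := x⁻¹ * g * x) ⟨x, rfl⟩ (not_lt.1 hc))
  obtain ⟨R, hR⟩ := (hg.image (fun h => wordLength S (h ^ n))).bddAbove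
  have hR' : ∀ x : G, wordLength S ((x⁻¹ * g * x) ^ n) ≤ R :=
    fun x => hR ⟨x⁻¹ * g * x, ⟨x, rfl⟩, rfl⟩
  have hd : ∀ x, wordDist S x (g ^ n * x) = wordLength S ((x⁻¹ * g * x) ^ n) := by
    intro x
    rw [← hpow, wordDist, mul_assoc]
  set K := 2 * (2 * δ + R) + 4 with hK
  have hrep : ∀ m : ℕ, ∀ x : G, wordLength S x ≤ m →
      ∃ z ∈ Subgroup.zpowers g, wordLength S (z * x) ≤ K := by
    have hz : g ^ n ∈ Subgroup.zpowers g := Subgroup.npow_mem_zpowers g n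
    intro m
    induction m with
    | zero => exact fun x hx => ⟨1, one_mem _, by rw [one_mul]; omega⟩
    | succ m ih =>
      intro x hx
      by_cases hc : wordLength S x ≤ K
      · exact ⟨1, one_mem _, by rwa [one_mul]⟩
      · rcases shorten hGen hδ (g ^ n) (fun x => (hd x).trans_le (hR' x))
          (fun x => (hn' x).trans_eq (hd x).symm) x (by omega) with h | h
        · obtain ⟨z, hz1, hz2⟩ := ih (g ^ n * x) (by omega)
          exact ⟨z * g ^ n, mul_mem hz1 hz, by rwa [mul_assoc]⟩
        · obtain ⟨z, hz1, hz2⟩ := ih ((g ^ n)⁻¹ * x) (by omega)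
          exact ⟨z * (g ^ n)⁻¹, mul_mem hz1 (inv_mem hz), by rwa [mul_assoc]⟩
  refine ⟨Subgroup.zpowers g, inferInstance, ?_, ?_⟩
  · exact Set.infinite_coe_iff.2 (infinite_zpowers.2 hinf)
  · haveI : Finite {h : G | wordLength S h ≤ K} := ball_finite hGen K
    haveI : Finite (G ⧸ Subgroup.zpowers g) := by
      refine Finite.of_surjective
        (fun u : {h : G | wordLength S h ≤ K} => (QuotientGroup.mk (u.1⁻¹) : G ⧸ _)) ?_
      intro q
      obtain ⟨x, rfl⟩ := QuotientGroup.mk_surjective q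
      obtain ⟨z, hz1, hz2⟩ := hrep _ x⁻¹ le_rfl
      refine ⟨⟨z * x⁻¹, hz2⟩, ?_⟩
      rw [QuotientGroup.eq]
      simpa using hz1
    exact Subgroup.index_ne_zero_of_finite
end

section
/- Let G be a hyperbolic group with finite generating set Σ, and for g, g' ∈ G set ⟨g, g'⟩ = |g| + |g'| − |gg'|. For every fixed integer n ≥ 0, the language L_n = {(x, y) ∈ Λ × Λ : ⟨x̄, ȳ⟩ = n} over the paired alphabet (encoding pairs of words over Σ by padding the shorter word with a padding symbol $) is regular, where Λ is the language of geodesic words over Σ and x̄ denotes the element of G represented by the word x. -/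
section Languages

variable {G : Type*} [Group G]

/-- Evaluation of a word over the alphabet `↥S` as an element of `G`. -/
def evalWord (S : Finset G) (w : List {x : G // x ∈ S}) : G :=
  (w.map Subtype.val).prod

/-- The language `Λ` of geodesic words over `Σ`: words whose length equals the
word length of the group element they represent. -/
def geodesicLanguage (S : Finset G) : Language {x : G // x ∈ S} :=
  {w | w.length = wordLength (↑S : Set G) (evalWord S w)}

end Languages

/-- Encode a pair of words over `A` as a single word over `(A ∪ {\$})²`, where the
padding symbol `\$` is modelled by `none`, by padding the shorter word. -/
def padPair {A : Type*} (x y : List A) : List (Option A × Option A) :=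
  (x.map some ++ List.replicate (y.length - x.length) none).zip
    (y.map some ++ List.replicate (x.length - y.length) none)

section Helpers

variable {G : Type*} [Group G]

lemma wl_le_s8 (S : Finset G) (l : List {x : G // x ∈ S}) :
    wordLength (↑S : Set G) (evalWord S l) ≤ l.length := by
  apply Nat.sInf_le
  refine ⟨l.map Subtype.val, ?_, by simp, rfl⟩
  intro x hx
  obtain ⟨a, -, rfl⟩ := List.mem_map.1 hx
  exact a.2

lemma evalWord_append (S : Finset G) (a b : List {x : G // x ∈ S}) :
    evalWord S (a ++ b) = evalWord S a * evalWord S b := by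
  simp [evalWord]

lemma wl_exists_s8 (S : Finset G) (hGen : IsGenSet (↑S : Set G)) (g : G) :
    ∃ l : List {x : G // x ∈ S}, evalWord S l = g ∧ l.length = wordLength (↑S : Set G) g := by
  have hne : {n | ∃ w : List G, (∀ x ∈ w, x ∈ (↑S : Set G)) ∧ w.length = n ∧ w.prod = g}.Nonempty := by
    have hg : g ∈ Subgroup.closure (↑S : Set G) := by rw [hGen.2.2]; trivial
    rw [← Subgroup.mem_toSubmonoid, Subgroup.closure_toSubmonoid] at hg
    obtain ⟨l, hl, hp⟩ := Submonoid.exists_list_of_mem_closure hg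
    refine ⟨l.length, l, ?_, rfl, hp⟩
    intro x hx
    rcases hl x hx with h | h
    · exact h
    · have := hGen.2.1 _ h
      rwa [inv_inv] at this
  obtain ⟨w, hw, hlen, hp⟩ := Nat.sInf_mem hne
  refine ⟨w.attach.map (fun x => ⟨x.1, hw x.1 x.2⟩), ?_, ?_⟩
  · unfold evalWord
    rw [List.map_map, ← hp]
    congr 1
    exact List.attach_map_subtype_val w
  · rw [List.length_map, List.length_attach]
    exact hlen

lemma wl_mul_s8 (S : Finset G) (hGen : IsGenSet (↑S : Set G)) (g h : G) :
    wordLength (↑S : Set G) (g * h) ≤ wordLength (↑S : Set G) g + wordLength (↑S : Set G) h := by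
  obtain ⟨a, rfl, ha⟩ := wl_exists_s8 S hGen g
  obtain ⟨b, rfl, hb⟩ := wl_exists_s8 S hGen h
  rw [← evalWord_append, ← ha, ← hb, ← List.length_append]
  exact wl_le_s8 _ _

lemma wl_one (S : Finset G) : wordLength (↑S : Set G) 1 = 0 :=
  Nat.le_zero.1 (wl_le_s8 S [])

lemma wl_inv_le_s8 (S : Finset G) (hGen : IsGenSet (↑S : Set G)) (g : G) :
    wordLength (↑S : Set G) g⁻¹ ≤ wordLength (↑S : Set G) g := by
  obtain ⟨a, ha1, ha⟩ := wl_exists_s8 S hGen g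
  rw [← ha]
  apply Nat.sInf_le
  refine ⟨((a.map Subtype.val).map (fun x => x⁻¹)).reverse, ?_, by simp, ?_⟩
  · intro x hx
    simp only [List.map_map, List.mem_reverse, List.mem_map] at hx
    obtain ⟨y, -, rfl⟩ := hx
    exact hGen.2.1 _ y.2
  · rw [← List.prod_inv_reverse, ← ha1]; rfl

lemma wl_inv_s8 (S : Finset G) (hGen : IsGenSet (↑S : Set G)) (g : G) :
    wordLength (↑S : Set G) g⁻¹ = wordLength (↑S : Set G) g :=
  le_antisymm (wl_inv_le_s8 S hGen g) (by simpa using wl_inv_le_s8 S hGen g⁻¹)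

lemma wd_symm (S : Finset G) (hGen : IsGenSet (↑S : Set G)) (g h : G) :
    wordDist (↑S : Set G) g h = wordDist (↑S : Set G) h g := by
  unfold wordDist
  rw [← wl_inv_s8 S hGen]; simp

lemma wd_tri_s8 (S : Finset G) (hGen : IsGenSet (↑S : Set G)) (a b c : G) :
    wordDist (↑S : Set G) a c ≤ wordDist (↑S : Set G) a b + wordDist (↑S : Set G) b c := by
  unfold wordDist
  have := wl_mul_s8 S hGen (a⁻¹ * b) (b⁻¹ * c)
  simpa [mul_assoc] using this

lemma geod_exists (S : Finset G) (hGen : IsGenSet (↑S : Set G)) (g h : G) :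
    ∃ γ : ℕ → G, IsGeodesicSegment (↑S : Set G) γ (wordDist (↑S : Set G) g h) ∧ γ 0 = g ∧
      γ (wordDist (↑S : Set G) g h) = h := by
  obtain ⟨l, hl, hlen⟩ := wl_exists_s8 S hGen (g⁻¹ * h)
  set γ : ℕ → G := fun i => g * evalWord S (l.take i) with hγ
  have hlen' : l.length = wordDist (↑S : Set G) g h := hlen
  have h0 : γ 0 = g := by simp [hγ, evalWord]
  have h1 : γ (wordDist (↑S : Set G) g h) = h := by
    simp [hγ, ← hlen', hl]
  have up : ∀ i j, i ≤ j → j ≤ l.length → wordDist (↑S : Set G) (γ i) (γ j) ≤ j - i := by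
    intro i j hij hj
    have e : l.take j = l.take i ++ (l.take j).drop i := by
      conv_lhs => rw [← List.take_append_drop i (l.take j)]
      rw [List.take_take, min_eq_left hij]
    have : (γ i)⁻¹ * γ j = evalWord S ((l.take j).drop i) := by
      simp only [hγ]
      conv_lhs => rw [e, evalWord_append]
      simp [mul_assoc]
    unfold wordDist
    rw [this]
    refine (wl_le_s8 _ _).trans ?_
    rw [List.length_drop, List.length_take]
    omega
  have key : ∀ i j, i ≤ j → j ≤ l.length → wordDist (↑S : Set G) (γ i) (γ j) = j - i := by
    intro i j hij hj
    have a1 := up 0 i (Nat.zero_le _) (hij.trans hj)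
    have a2 := up i j hij hj
    have a3 := up j l.length hj le_rfl
    have t1 := wd_tri_s8 S hGen (γ 0) (γ i) (γ l.length)
    have t2 := wd_tri_s8 S hGen (γ i) (γ j) (γ l.length)
    rw [h0, hlen', h1, ← hlen'] at t1
    rw [h0] at a1
    rw [hlen', h1] at t2
    rw [hlen', h1, ← hlen'] at a3
    omega
  refine ⟨γ, ?_, h0, h1⟩
  intro i j hi hj
  rw [← hlen'] at hi hj
  rcases le_total i j with h | h
  · rw [key i j h hj, Nat.dist_eq_sub_of_le h]
  · rw [wd_symm S hGen, key j i h hi, Nat.dist_comm, Nat.dist_eq_sub_of_le h]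

lemma fellow (S : Finset G) (hGen : IsGenSet (↑S : Set G)) (δ : ℕ)
    (hd : IsDeltaHyperbolic (↑S : Set G) δ) (g h : G) (m : ℕ)
    (hm : wordLength (↑S : Set G) g + wordLength (↑S : Set G) h ≤
      wordLength (↑S : Set G) (g * h) + m) :
    ∃ c, wordLength (↑S : Set G) c ≤ m + 3 * δ + 1 ∧
      wordLength (↑S : Set G) (g * h) =
        wordLength (↑S : Set G) (g * c) + wordLength (↑S : Set G) (c⁻¹ * h) := by
  obtain ⟨a, ha, ha0, ha1⟩ := geod_exists S hGen 1 g
  obtain ⟨b, hb, hb0, hb1⟩ := geod_exists S hGen g (g * h)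
  obtain ⟨z, hz, hz0, hz1⟩ := geod_exists S hGen 1 (g * h)
  have e1 : wordDist (↑S : Set G) 1 g = wordLength (↑S : Set G) g := by simp [wordDist]
  have e2 : wordDist (↑S : Set G) g (g * h) = wordLength (↑S : Set G) h := by simp [wordDist]
  have e3 : wordDist (↑S : Set G) 1 (g * h) = wordLength (↑S : Set G) (g * h) := by simp [wordDist]
  rw [e1] at ha ha1
  rw [e2] at hb hb1
  rw [e3] at hz hz1
  set n₁ := wordLength (↑S : Set G) g
  set n₂ := wordLength (↑S : Set G) h
  set n₃ := wordLength (↑S : Set G) (g * h)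
  have thin := hd a b z n₁ n₂ n₃ ha hb hz (by rw [ha0, hz0]) (by rw [ha1, hb0])
    (by rw [hb1, hz1])
  have self : ∀ x : G, wordDist (↑S : Set G) x x = 0 := fun x => by simp [wordDist, wl_one]
  classical
  let P : ℕ → Prop := fun k => ∃ i ≤ n₁, wordDist (↑S : Set G) (z k) (a i) ≤ δ
  have P0 : P 0 := ⟨0, Nat.zero_le _, by rw [hz0, ha0, self]; exact Nat.zero_le _⟩
  have hk : Nat.findGreatest P n₃ ≤ n₃ := Nat.findGreatest_le _
  have hP : P (Nat.findGreatest P n₃) := Nat.findGreatest_spec (Nat.zero_le _) P0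
  have hmax : ∀ k, Nat.findGreatest P n₃ < k → k ≤ n₃ → ¬ P k :=
    fun k h1 h2 => Nat.findGreatest_is_greatest h1 h2
  generalize Nat.findGreatest P n₃ = k at hk hP hmax
  obtain ⟨i, hi, hPi⟩ := hP
  have hQ : ∃ j ≤ n₂, wordDist (↑S : Set G) (z k) (b j) ≤ δ + 1 := by
    rcases hk.eq_or_lt with h | h
    · refine ⟨n₂, le_rfl, ?_⟩
      rw [h, hz1, hb1, self]; exact Nat.zero_le _
    · obtain ⟨j, hj | hj⟩ := thin (k + 1) h
      · exact absurd ⟨j, hj⟩ (hmax (k + 1) (Nat.lt_succ_self _) h)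
      · refine ⟨j, hj.1, ?_⟩
        have := wd_tri_s8 S hGen (z k) (z (k + 1)) (b j)
        have h2 := hz k (k + 1) hk h
        rw [Nat.dist_eq_sub_of_le (Nat.le_succ k)] at h2
        omega
  obtain ⟨j, hj, hQj⟩ := hQ
  have d1 : wordDist (↑S : Set G) 1 (a i) = i := by
    have := ha 0 i (Nat.zero_le _) hi
    rw [ha0, Nat.dist_eq_sub_of_le (Nat.zero_le _)] at this; omega
  have d2 : wordDist (↑S : Set G) (a i) g = n₁ - i := by
    have := ha i n₁ hi le_rfl
    rwa [ha1, Nat.dist_eq_sub_of_le hi] at this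
  have d3 : wordDist (↑S : Set G) (b j) (g * h) = n₂ - j := by
    have := hb j n₂ hj le_rfl
    rwa [hb1, Nat.dist_eq_sub_of_le hj] at this
  have d4 : wordDist (↑S : Set G) 1 (z k) = k := by
    have := hz 0 k (Nat.zero_le _) hk
    rw [hz0, Nat.dist_eq_sub_of_le (Nat.zero_le _)] at this; omega
  have d5 : wordDist (↑S : Set G) (z k) (g * h) = n₃ - k := by
    have := hz k n₃ hk le_rfl
    rwa [hz1, Nat.dist_eq_sub_of_le hk] at this
  have t1 := wd_tri_s8 S hGen 1 (a i) (g * h)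
  have t2 := wd_tri_s8 S hGen (a i) (z k) (g * h)
  have t3 := wd_tri_s8 S hGen (z k) (b j) (g * h)
  have t4 := wd_tri_s8 S hGen g (a i) (z k)
  rw [wd_symm S hGen g (a i)] at t4
  rw [wd_symm S hGen (a i) (z k)] at t2 t4
  refine ⟨g⁻¹ * z k, ?_, ?_⟩
  · change wordDist (↑S : Set G) g (z k) ≤ _
    omega
  · have f1 : wordLength (↑S : Set G) (g * (g⁻¹ * z k)) = k := by
      rw [mul_inv_cancel_left]; simpa [wordDist] using d4
    have f2 : wordLength (↑S : Set G) ((g⁻¹ * z k)⁻¹ * h) = n₃ - k := by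
      rw [← d5]; simp [wordDist, mul_assoc]
    rw [f1, f2]; omega

/-- Words whose defect is at most `n`. -/
def almostGeod (S : Finset G) (n : ℕ) : Language {x : G // x ∈ S} :=
  {w | w.length ≤ wordLength (↑S : Set G) (evalWord S w) + n}

lemma mem_almostGeod (S : Finset G) (n : ℕ) (w : List {x : G // x ∈ S}) :
    w ∈ almostGeod S n ↔ w.length ≤ wordLength (↑S : Set G) (evalWord S w) + n := Iff.rfl

lemma almostGeod_transfer (S : Finset G) (hGen : IsGenSet (↑S : Set G)) (δ : ℕ)
    (hd : IsDeltaHyperbolic (↑S : Set G) δ) (n : ℕ) (u u' : List {x : G // x ∈ S})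
    (hu' : u' ∈ almostGeod S n)
    (hdef : u.length + wordLength (↑S : Set G) (evalWord S u') =
      u'.length + wordLength (↑S : Set G) (evalWord S u))
    (htype : ∀ c, wordLength (↑S : Set G) c ≤ n + 2 + 3 * δ + 1 →
      wordLength (↑S : Set G) (evalWord S u * c) + wordLength (↑S : Set G) (evalWord S u') =
      wordLength (↑S : Set G) (evalWord S u' * c) + wordLength (↑S : Set G) (evalWord S u))
    (v : List {x : G // x ∈ S}) (hv : u ++ v ∈ almostGeod S n) : u' ++ v ∈ almostGeod S n := by
  induction v using List.reverseRecOn with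
  | nil => simpa using hu'
  | append_singleton v s ih =>
    simp only [mem_almostGeod, evalWord_append, List.length_append, List.length_singleton] at *
    have hs : wordLength (↑S : Set G) (evalWord S [s]) ≤ 1 := wl_le_s8 S [s]
    have hs' := wl_inv_s8 S hGen (evalWord S [s])
    have hvl := wl_le_s8 S v
    have hul := wl_le_s8 S u'
    have m1 := wl_mul_s8 S hGen (evalWord S u * evalWord S v) (evalWord S [s])
    have m2 := wl_mul_s8 S hGen (evalWord S u' * (evalWord S v * evalWord S [s])) (evalWord S [s])⁻¹
    have m3 := wl_mul_s8 S hGen (evalWord S v) (evalWord S [s])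
    rw [← mul_assoc, mul_inv_cancel_right] at m2
    rw [mul_assoc] at m1
    have h1 := ih (by omega)
    rw [← mul_assoc] at m1
    obtain ⟨c, hc, hc2⟩ := fellow S hGen δ hd (evalWord S u') (evalWord S v * evalWord S [s]) (n + 2)
      (by rw [← mul_assoc]; omega)
    have h2 := htype c hc
    have h3 := wl_mul_s8 S hGen (evalWord S u * c) (c⁻¹ * (evalWord S v * evalWord S [s]))
    rw [mul_assoc, mul_inv_cancel_left] at h3
    omega

lemma almostGeod_regular (S : Finset G) (hGen : IsGenSet (↑S : Set G)) (δ : ℕ)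
    (hd : IsDeltaHyperbolic (↑S : Set G) δ) (n : ℕ) : (almostGeod S n).IsRegular := by
  classical
  rw [Language.isRegular_iff_finite_range_leftQuotient]
  set R := n + 2 + 3 * δ + 1 with hR
  let T : List {x : G // x ∈ S} → Option (Fin (n + 1) ×
      ({l : List {x : G // x ∈ S} // l.length ≤ R} → Fin (2 * R + 1))) := fun u =>
    if u ∈ almostGeod S n then
      some (Fin.ofNat _ (u.length - wordLength (↑S : Set G) (evalWord S u)),
        fun c => Fin.ofNat _ (wordLength (↑S : Set G) (evalWord S u * evalWord S c.1) + R
          - wordLength (↑S : Set G) (evalWord S u)))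
    else none
  have : Finite {l : List {x : G // x ∈ S} // l.length ≤ R} := (List.finite_length_le _ R).to_subtype
  have pref : ∀ u v, u ++ v ∈ almostGeod S n → u ∈ almostGeod S n := by
    intro u v h
    simp only [mem_almostGeod, evalWord_append, List.length_append] at *
    have := wl_mul_s8 S hGen (evalWord S u) (evalWord S v)
    have := wl_le_s8 S v
    omega
  have half : ∀ u u', T u = T u' → ∀ v, u ++ v ∈ almostGeod S n → u' ++ v ∈ almostGeod S n := by
    intro u u' hT v hv
    have hu := pref u v hv
    by_cases hu' : u' ∈ almostGeod S n
    swap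
    · simp [T, hu, hu'] at hT
    simp only [T, hu, hu', if_true, Option.some.injEq, Prod.mk.injEq] at hT
    obtain ⟨hT1, hT2⟩ := hT
    have l1 := wl_le_s8 S u
    have l2 := wl_le_s8 S u'
    rw [mem_almostGeod] at hu
    have hu'' := hu'
    rw [mem_almostGeod] at hu''
    refine almostGeod_transfer S hGen δ hd n u u' hu' ?_ ?_ v hv
    · have := congrArg Fin.val hT1
      simp only [Fin.val_ofNat] at this
      rw [Nat.mod_eq_of_lt (by omega), Nat.mod_eq_of_lt (by omega)] at this
      omega
    · intro c hc
      obtain ⟨l, rfl, hl⟩ := wl_exists_s8 S hGen c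
      have := congrArg Fin.val (congrFun hT2 ⟨l, by omega⟩)
      simp only [Fin.val_ofNat] at this
      have m1 := wl_mul_s8 S hGen (evalWord S u) (evalWord S l)
      have m2 := wl_mul_s8 S hGen (evalWord S u') (evalWord S l)
      have m3 := wl_mul_s8 S hGen (evalWord S u * evalWord S l) (evalWord S l)⁻¹
      have m4 := wl_mul_s8 S hGen (evalWord S u' * evalWord S l) (evalWord S l)⁻¹
      rw [mul_inv_cancel_right, wl_inv_s8 S hGen] at m3 m4
      rw [Nat.mod_eq_of_lt (by omega), Nat.mod_eq_of_lt (by omega)] at this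
      omega
  have hfac : Function.FactorsThrough (almostGeod S n).leftQuotient T := by
    intro u u' h
    ext v
    exact ⟨half u u' h v, half u' u h.symm v⟩
  refine (Set.finite_range (Function.extend T (almostGeod S n).leftQuotient (fun _ => 0))).subset ?_
  rintro _ ⟨u, rfl⟩
  exact ⟨T u, hfac.extend_apply _ u⟩

end Helpers

section LangHelpers

universe u v

lemma reg_congr {α : Type u} {L L' : Language α} (h : L'.IsRegular) (e : ∀ w, w ∈ L ↔ w ∈ L') :
    L.IsRegular := by
  have : L = L' := Set.ext e
  rw [this]
  exact h

/-- A language padded by arbitrarily many `none`s. -/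
def padLang {α : Type u} (A : Language α) : Language (Option α) :=
  {w | ∃ x ∈ A, ∃ k, w = x.map some ++ List.replicate k none}

/-- The automaton for the padded language. -/
def padDFA {α : Type u} {σ : Type v} (M : DFA α σ) : DFA (Option α) (Option (σ × Bool)) where
  step s a := match s, a with
    | some (s, false), some a => some (M.step s a, false)
    | some (s, _), none => some (s, true)
    | _, _ => none
  start := some (M.start, false)
  accept := {s | ∃ t b, s = some (t, b) ∧ t ∈ M.accept}

lemma padDFA_none {α : Type u} {σ : Type v} (M : DFA α σ) (w : List (Option α)) :
    (padDFA M).evalFrom none w = none := by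
  induction w with
  | nil => rfl
  | cons a w ih => rw [DFA.evalFrom_cons]; exact ih

lemma padDFA_true {α : Type u} {σ : Type v} (M : DFA α σ) (w : List (Option α)) (s : σ) :
    (padDFA M).evalFrom (some (s, true)) w ∈ (padDFA M).accept ↔
      s ∈ M.accept ∧ ∃ k, w = List.replicate k none := by
  induction w with
  | nil =>
    simp only [DFA.evalFrom_nil]
    constructor
    · rintro ⟨t, b, h, ht⟩
      cases h
      exact ⟨ht, 0, rfl⟩
    · rintro ⟨h, -⟩
      exact ⟨s, true, rfl, h⟩
  | cons a w ih =>
    rw [DFA.evalFrom_cons]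
    cases a with
    | none =>
      change (padDFA M).evalFrom (some (s, true)) w ∈ (padDFA M).accept ↔ _
      rw [ih]
      refine and_congr_right fun _ => ⟨?_, ?_⟩
      · rintro ⟨k, rfl⟩
        exact ⟨k + 1, rfl⟩
      · rintro ⟨k, hk⟩
        cases k with
        | zero => simp at hk
        | succ k => exact ⟨k, by simpa [List.replicate_succ] using hk⟩
    | some a =>
      change (padDFA M).evalFrom none w ∈ (padDFA M).accept ↔ _
      rw [padDFA_none]
      constructor
      · rintro ⟨t, b, h, -⟩
        cases h
      · rintro ⟨-, k, hk⟩
        cases k <;> simp [List.replicate_succ] at hk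

lemma padDFA_false {α : Type u} {σ : Type v} (M : DFA α σ) (w : List (Option α)) (s : σ) :
    (padDFA M).evalFrom (some (s, false)) w ∈ (padDFA M).accept ↔
      ∃ x, M.evalFrom s x ∈ M.accept ∧ ∃ k, w = x.map some ++ List.replicate k none := by
  induction w generalizing s with
  | nil =>
    simp only [DFA.evalFrom_nil]
    constructor
    · rintro ⟨t, b, h, ht⟩
      cases h
      exact ⟨[], ht, 0, rfl⟩
    · rintro ⟨x, h, k, hk⟩
      have hx : x = [] := by
        cases x with
        | nil => rfl
        | cons => simp at hk
      subst hx
      exact ⟨s, false, rfl, h⟩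
  | cons a w ih =>
    rw [DFA.evalFrom_cons]
    cases a with
    | none =>
      change (padDFA M).evalFrom (some (s, true)) w ∈ (padDFA M).accept ↔ _
      rw [padDFA_true]
      constructor
      · rintro ⟨hs, k, rfl⟩
        exact ⟨[], hs, k + 1, rfl⟩
      · rintro ⟨x, hx, k, hk⟩
        cases x with
        | nil =>
          cases k with
          | zero => simp at hk
          | succ k => exact ⟨hx, k, by simpa [List.replicate_succ] using hk⟩
        | cons => simp at hk
    | some a =>
      change (padDFA M).evalFrom (some (M.step s a, false)) w ∈ (padDFA M).accept ↔ _
      rw [ih]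
      constructor
      · rintro ⟨x, hx, k, rfl⟩
        exact ⟨a :: x, hx, k, rfl⟩
      · rintro ⟨x, hx, k, hk⟩
        cases x with
        | nil => cases k <;> simp [List.replicate_succ] at hk
        | cons b x =>
          simp only [List.map_cons, List.cons_append, List.cons.injEq, Option.some.injEq] at hk
          obtain ⟨rfl, hk⟩ := hk
          exact ⟨x, hx, k, hk⟩

lemma padLang_regular {α : Type u} {A : Language α} (hA : A.IsRegular) :
    (padLang A).IsRegular := by
  obtain ⟨σ, _, M, rfl⟩ := hA
  refine ⟨Option (σ × Bool), inferInstance, padDFA M, ?_⟩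
  ext w
  exact padDFA_false M w M.start

/-- Padded product of two languages. -/
def padProd {α : Type u} (A B : Language α) : Language (Option α × Option α) :=
  {w | ∃ x ∈ A, ∃ y ∈ B, w = padPair x y}

lemma comap_regular {α : Type u} {β : Type v} (f : α → β) {A : Language β} (hA : A.IsRegular) :
    Language.IsRegular ({w | w.map f ∈ A} : Language α) := by
  obtain ⟨σ, i, M, rfl⟩ := hA
  refine Language.isRegular_iff.2 ⟨σ, i, M.comap f, M.accepts_comap f⟩

lemma all_regular {α : Type u} (p : α → Prop) :
    Language.IsRegular ({w | ∀ a ∈ w, p a} : Language α) := by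
  classical
  refine Language.isRegular_iff.2 ⟨Prop, inferInstance, ⟨fun s a => s ∧ p a, True, {s | s}⟩, ?_⟩
  have key : ∀ (w : List α) (s : Prop),
      DFA.evalFrom ⟨fun s a => s ∧ p a, True, {s : Prop | s}⟩ s w ↔ s ∧ ∀ a ∈ w, p a := by
    intro w
    induction w with
    | nil => intro s; simp
    | cons a w ih => intro s; rw [DFA.evalFrom_cons, ih]; simp [and_assoc]
  ext w
  exact (key w True).trans (by simp; rfl)

lemma padProd_eq {α : Type u} (A B : Language α) : padProd A B =
    (({w | w.map Prod.fst ∈ padLang A} : Language (Option α × Option α)) ⊓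
      ({w | w.map Prod.snd ∈ padLang B} : Language (Option α × Option α))) ⊓
      ({w | ∀ a ∈ w, a ≠ (none, none)} : Language (Option α × Option α)) := by
  ext w
  constructor
  · rintro ⟨x, hx, y, hy, rfl⟩
    refine ⟨⟨⟨x, hx, y.length - x.length, ?_⟩, ⟨y, hy, x.length - y.length, ?_⟩⟩, ?_⟩
    · unfold padPair
      rw [List.map_fst_zip]
      simp; omega
    · unfold padPair
      rw [List.map_snd_zip]
      simp; omega
    · intro a ha
      rintro rfl
      obtain ⟨i, hi, h⟩ := List.getElem_of_mem ha
      have hi' : i < x.length ∨ i < y.length := by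
        simp only [padPair, List.length_zip, List.length_append, List.length_map,
          List.length_replicate] at hi
        omega
      simp only [padPair, List.getElem_zip, Prod.mk.injEq] at h
      rw [List.getElem_append, List.getElem_append] at h
      obtain ⟨h1, h2⟩ := h
      split_ifs at h1 h2 with c1 c2
      · simp at h1
      · simp at h1
      · simp at h2
      · rw [List.length_map] at *
        omega
  · rintro ⟨⟨⟨x, hx, k, h1⟩, ⟨y, hy, l, h2⟩⟩, h3⟩
    refine ⟨x, hx, y, hy, ?_⟩
    have hw : w = (w.map Prod.fst).zip (w.map Prod.snd) := by
      rw [← List.zip_of_prod rfl rfl]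
    have l1 := congrArg List.length h1
    have l2 := congrArg List.length h2
    simp only [List.length_map, List.length_append, List.length_replicate] at l1 l2
    have hkl : k = 0 ∨ l = 0 := by
      by_contra hcon
      push Not at hcon
      have hlt : w.length - 1 < w.length := by omega
      apply h3 _ (List.getElem_mem hlt)
      have e1 : (w.map Prod.fst)[w.length - 1]'(by simpa using hlt) = none := by
        simp only [h1]
        rw [List.getElem_append_right (by simp; omega)]
        simp
      have e2 : (w.map Prod.snd)[w.length - 1]'(by simpa using hlt) = none := by
        simp only [h2]
        rw [List.getElem_append_right (by simp; omega)]
        simp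
      rw [List.getElem_map] at e1 e2
      exact Prod.ext e1 e2
    have hk : k = y.length - x.length := by omega
    have hl : l = x.length - y.length := by omega
    rw [hw, h1, h2, hk, hl]
    rfl

lemma padProd_regular {α : Type u} {A B : Language α} (hA : A.IsRegular) (hB : B.IsRegular) :
    (padProd A B).IsRegular := by
  rw [padProd_eq]
  exact ((comap_regular _ (padLang_regular hA)).inf (comap_regular _ (padLang_regular hB))).inf
    (all_regular _)

lemma biUnion_regular {α : Type u} {ι : Type v} (s : Finset ι) (L : ι → Language α)
    (h : ∀ i, (L i).IsRegular) : Language.IsRegular ({w | ∃ i ∈ s, w ∈ L i} : Language α) := by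
  classical
  induction s using Finset.induction_on with
  | empty =>
    have := all_regular (α := α) (fun _ => True)
    refine reg_congr this.compl fun w => ?_
    change (∃ i ∈ (∅ : Finset ι), w ∈ L i) ↔ ¬ (∀ a ∈ w, True)
    simp
  | insert a s _ ih =>
    refine reg_congr ((h a).add ih) fun w => ?_
    change (∃ i ∈ insert a s, w ∈ L i) ↔ (w ∈ L a ∨ ∃ i ∈ s, w ∈ L i)
    simp

lemma concat_pair_regular {α : Type u} {A B C : Language α} (hA : A.IsRegular) (hB : B.IsRegular)
    (hC : C.IsRegular) : Language.IsRegular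
      ({w | ∃ x ∈ A, ∃ y ∈ B, x ++ y ∈ C ∧ w = padPair x y} : Language (Option α × Option α)) := by
  obtain ⟨σ, _, M, rfl⟩ := hC
  have h1 : ∀ q, Language.IsRegular ({x | M.eval x = q} : Language α) := fun q =>
    Language.isRegular_iff.2 ⟨σ, inferInstance, ⟨M.step, M.start, {q}⟩, rfl⟩
  have h2 : ∀ q, Language.IsRegular (M.acceptsFrom q) := fun q =>
    Language.isRegular_iff.2 ⟨σ, inferInstance, ⟨M.step, q, M.accept⟩, rfl⟩
  refine reg_congr (biUnion_regular Finset.univ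
    (fun q => padProd (A ⊓ ({x | M.eval x = q} : Language α)) (B ⊓ M.acceptsFrom q))
    (fun q => padProd_regular (hA.inf (h1 q)) (hB.inf (h2 q)))) fun w => ?_
  constructor
  · rintro ⟨x, hx, y, hy, hxy, rfl⟩
    refine ⟨M.eval x, Finset.mem_univ _, x, ⟨hx, rfl⟩, y, ⟨hy, ?_⟩, rfl⟩
    rw [DFA.mem_accepts, DFA.eval, DFA.evalFrom_of_append] at hxy
    exact hxy
  · rintro ⟨q, -, x, ⟨hx, rfl⟩, y, ⟨hy, hq⟩, rfl⟩
    refine ⟨x, hx, y, hy, ?_, rfl⟩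
    rw [DFA.mem_accepts, DFA.eval, DFA.evalFrom_of_append]
    exact hq

lemma padPair_inj {α : Type u} {x y x' y' : List α} (h : padPair x y = padPair x' y') :
    x = x' ∧ y = y' := by
  have a1 := congrArg (fun w => (w.map Prod.fst).reduceOption) h
  have a2 := congrArg (fun w => (w.map Prod.snd).reduceOption) h
  have f : ∀ x y : List α, ((padPair x y).map Prod.fst).reduceOption = x := by
    intro x y
    unfold padPair
    rw [List.map_fst_zip (by simp; omega), List.reduceOption_append]
    simp [List.reduceOption]
  have g : ∀ x y : List α, ((padPair x y).map Prod.snd).reduceOption = y := by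
    intro x y
    unfold padPair
    rw [List.map_snd_zip (by simp; omega), List.reduceOption_append]
    simp [List.reduceOption]
  simp only [f, g] at a1 a2
  exact ⟨a1, a2⟩

end LangHelpers

/-- (Lemma 5B) For each fixed `n`, the language of padded pairs of
geodesic words `(x, y)` with `⟨x̄, ȳ⟩ = |x̄| + |ȳ| - |x̄ȳ| = n` is regular. -/
theorem statement_8 {G : Type*} [Group G] (S : Finset G) (hGen : IsGenSet (↑S : Set G))
    (hHyp : IsHyperbolic (↑S : Set G)) (n : ℕ) :
    Language.IsRegular (({w | ∃ x y : List {a : G // a ∈ S}, x ∈ geodesicLanguage S ∧ y ∈ geodesicLanguage S ∧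
        wordLength (↑S : Set G) (evalWord S x) + wordLength (↑S : Set G) (evalWord S y) =
          wordLength (↑S : Set G) (evalWord S x * evalWord S y) + n ∧
        w = padPair x y} :
      Language (Option {a : G // a ∈ S} × Option {a : G // a ∈ S}))) := by
  obtain ⟨δ, hd⟩ := hHyp
  have hgeo : geodesicLanguage S = almostGeod S 0 := by
    ext w
    have := wl_le_s8 S w
    change w.length = _ ↔ w.length ≤ _ + 0
    omega
  have hΛ : (geodesicLanguage S).IsRegular := hgeo ▸ almostGeod_regular S hGen δ hd 0
  have hreg : ∀ m, Language.IsRegular _ := fun m =>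
    concat_pair_regular hΛ hΛ (almostGeod_regular S hGen δ hd m)
  have hcat : ∀ m (x y : List {a : G // a ∈ S}), x ∈ geodesicLanguage S →
      y ∈ geodesicLanguage S → (x ++ y ∈ almostGeod S m ↔
        wordLength (↑S : Set G) (evalWord S x) + wordLength (↑S : Set G) (evalWord S y) ≤
          wordLength (↑S : Set G) (evalWord S x * evalWord S y) + m) := by
    intro m x y hx hy
    have hx' : x.length = wordLength (↑S : Set G) (evalWord S x) := hx
    have hy' : y.length = wordLength (↑S : Set G) (evalWord S y) := hy
    rw [mem_almostGeod, evalWord_append, List.length_append, hx', hy']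
  cases n with
  | zero =>
    refine reg_congr (hreg 0) fun w => ?_
    constructor
    · rintro ⟨x, y, hx, hy, h, rfl⟩
      exact ⟨x, hx, y, hy, (hcat 0 x y hx hy).2 h.le, rfl⟩
    · rintro ⟨x, hx, y, hy, h, rfl⟩
      refine ⟨x, y, hx, hy, ?_, rfl⟩
      have h1 := (hcat 0 x y hx hy).1 h
      have h2 := wl_mul_s8 S hGen (evalWord S x) (evalWord S y)
      omega
  | succ n =>
    refine reg_congr ((hreg (n + 1)).inf (hreg n).compl) fun w => ?_
    constructor
    · rintro ⟨x, y, hx, hy, h, rfl⟩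
      refine ⟨⟨x, hx, y, hy, (hcat _ x y hx hy).2 h.le, rfl⟩, ?_⟩
      rintro ⟨x', hx', y', hy', h', e⟩
      obtain ⟨rfl, rfl⟩ := padPair_inj e
      have := (hcat _ _ _ hx hy).1 h'
      omega
    · rintro ⟨⟨x, hx, y, hy, h, rfl⟩, hn⟩
      refine ⟨x, y, hx, hy, ?_, rfl⟩
      have h1 := (hcat _ x y hx hy).1 h
      by_contra hne
      exact hn ⟨x, hx, y, hy, (hcat _ x y hx hy).2 (by omega), rfl⟩
end
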